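/- The minimal cardinality of a non-guessable subset of ℕ^ℕ equals cov(M): for every family X ⊆ ℕ^ℕ with |X| < cov(M), there is a single function g ∈ ℕ^ℕ such that for each x ∈ X the set {n ∈ ℕ : g(n) = x(n)} is infinite. -/

import Mathlib

open Set

/-- cov(M): the minimal cardinality of a family of meager subsets of the Baire
space `ℕ → ℕ` covering it. -/
noncomputable def covMeager : Cardinal :=
  sInf {c | ∃ F : Set (Set (ℕ → ℕ)), Cardinal.mk F = c ∧
    (∀ A ∈ F, IsMeagre A) ∧ ⋃₀ F = Set.univ}

/-- `X ⊆ ℕ^ℕ` is guessable. -/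
def Guessable (X : Set (ℕ → ℕ)) : Prop :=
  ∃ g : ℕ → ℕ, ∀ x ∈ X, {n | g n = x n}.Infinite

/-- Every family indexed by `ι` is guessable. -/
def GuessIdx (ι : Type) : Prop :=
  ∀ f : ι → ℕ → ℕ, ∃ g : ℕ → ℕ, ∀ a, {n | g n = f a n}.Infinite

theorem guess_countable {ι : Type} (H : GuessIdx ι) {β : Type} [Countable β] [Nonempty β]
    (f : ι → ℕ → β) : ∃ g : ℕ → β, ∀ a, {n | g n = f a n}.Infinite := by
  obtain ⟨e, he⟩ := exists_injective_nat β
  obtain ⟨g, hg⟩ := H (fun a n => e (f a n))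
  refine ⟨fun n => Function.invFun e (g n), fun a => (hg a).mono ?_⟩
  intro n hn
  simp only [mem_ofPred_eq] at hn ⊢
  rw [hn]
  exact Function.leftInverse_invFun he _

theorem guess_on_sets {ι : Type} (H : GuessIdx ι) (f : ι → ℕ → ℕ) (X : ι → Set ℕ)
    (hX : ∀ a, (X a).Infinite) :
    ∃ g : ℕ → ℕ, ∀ a, {n | n ∈ X a ∧ g n = f a n}.Infinite := by
  classical
  choose Y hYX hYc using fun a (n : ℕ) => (hX a).exists_subset_card_eq (n + 1)
  obtain ⟨G, hG⟩ := guess_countable H (fun a n => (Y a n).image (fun k => (k, f a k)))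
  have hp : ∀ (n : ℕ) (K : Finset ℕ), ∃ p : ℕ × ℕ, p.1 ∉ K ∧
      ((∃ q ∈ G n, q.1 ∉ K) → p ∈ G n) := by
    intro n K
    by_cases h : ∃ q ∈ G n, q.1 ∉ K
    · obtain ⟨q, hq, hk⟩ := h
      exact ⟨q, hk, fun _ => hq⟩
    · obtain ⟨k, hk⟩ := Infinite.exists_notMem_finset K
      exact ⟨(k, 0), hk, fun h' => absurd h' h⟩
  choose pick hpick1 hpick2 using hp
  let K : ℕ → Finset ℕ := fun n => Nat.rec ∅ (fun n K => insert (pick n K).1 K) n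
  have hKs : ∀ n, K (n + 1) = insert (pick n (K n)).1 (K n) := fun n => rfl
  have hKc : ∀ n, (K n).card ≤ n := by
    intro n
    induction n with
    | zero => simp [K]
    | succ n ih =>
      rw [hKs]
      exact (Finset.card_insert_le _ _).trans (by omega)
  have hKm : Monotone K := monotone_nat_of_le_succ (fun n => by
    rw [hKs]; exact Finset.subset_insert _ _)
  let key : ℕ → ℕ := fun n => (pick n (K n)).1
  have hlt : ∀ m n, m < n → key m ≠ key n := by
    intro m n hmn h
    have h1 : key m ∈ K (m + 1) := by rw [hKs]; exact Finset.mem_insert_self _ _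
    have h2 : key m ∈ K n := hKm hmn h1
    rw [h] at h2
    exact hpick1 n (K n) h2
  have hinj : Function.Injective key := by
    intro m n h
    rcases lt_trichotomy m n with h' | h' | h'
    · exact absurd h (hlt _ _ h')
    · exact h'
    · exact absurd h.symm (hlt _ _ h')
  refine ⟨Function.extend key (fun n => (pick n (K n)).2) 0, fun a => ?_⟩
  refine Set.infinite_of_injOn_mapsTo (f := key) hinj.injOn ?_ (hG a)
  intro n hn
  simp only [mem_ofPred_eq] at hn ⊢
  rw [hinj.extend_apply]
  have hex : ∃ q ∈ G n, q.1 ∉ K n := by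
    have : ∃ k ∈ Y a n, k ∉ K n :=
      Finset.exists_mem_notMem_of_card_lt_card (by
        have := hKc n
        rw [hYc]; omega)
    obtain ⟨k, hk, hk'⟩ := this
    refine ⟨(k, f a k), ?_, hk'⟩
    rw [hn]
    exact Finset.mem_image_of_mem _ hk
  have hm := hpick2 n (K n) hex
  rw [hn, Finset.mem_image] at hm
  obtain ⟨k, hk, hk'⟩ := hm
  have e1 : key n = k := by simp only [key]; rw [← hk']
  rw [e1]
  refine ⟨hYX a n hk, ?_⟩
  rw [← hk']

theorem guess_on_sets' {ι : Type} (H : GuessIdx ι) {β : Type} [Countable β] [Nonempty β]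
    (f : ι → ℕ → β) (X : ι → Set ℕ) (hX : ∀ a, (X a).Infinite) :
    ∃ g : ℕ → β, ∀ a, {n | n ∈ X a ∧ g n = f a n}.Infinite := by
  obtain ⟨e, he⟩ := exists_injective_nat β
  obtain ⟨g, hg⟩ := guess_on_sets H (fun a n => e (f a n)) X hX
  refine ⟨fun n => Function.invFun e (g n), fun a => (hg a).mono ?_⟩
  rintro n ⟨h1, hn⟩
  refine ⟨h1, ?_⟩
  simp only [hn]
  exact Function.leftInverse_invFun he _

theorem escape {ι : Type} (H : GuessIdx ι) (p : ι → ℕ → ℕ) :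
    ∃ h : ℕ → ℕ, StrictMono h ∧ ∀ a, {n | p a (h n) ≤ h (n + 1)}.Infinite := by
  let ψ : ι → ℕ → ℕ := fun a m => ∑ i ∈ Finset.range (m + 1), (p a i + i)
  have hψp : ∀ a m, p a m + m ≤ ψ a m := fun a m =>
    Finset.single_le_sum (f := fun i => p a i + i) (fun _ _ => Nat.zero_le _)
      (Finset.mem_range.2 (Nat.lt_succ_self m))
  have hψm : ∀ a, Monotone (ψ a) := fun a => monotone_nat_of_le_succ (fun n => by
    simp only [ψ]
    rw [Finset.sum_range_succ _ (n + 1)]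
    exact Nat.le_add_right _ _)
  have hψi : ∀ a, id ≤ ψ a := fun a m => by have := hψp a m; simp only [id]; omega
  obtain ⟨g, hg⟩ := H (fun a n => (ψ a)^[n] n)
  let h : ℕ → ℕ := fun n => ∑ i ∈ Finset.range (n + 1), (g i + 1)
  have hhg : ∀ n, g n + 1 ≤ h n := fun n =>
    Finset.single_le_sum (f := fun i => g i + 1) (fun _ _ => Nat.zero_le _)
      (Finset.mem_range.2 (Nat.lt_succ_self n))
  have hhm : StrictMono h := strictMono_nat_of_lt_succ (fun n => by
    simp only [h]
    rw [Finset.sum_range_succ _ (n + 1)]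
    omega)
  refine ⟨h, hhm, fun a => ?_⟩
  intro hfin
  obtain ⟨N, hN⟩ := hfin.bddAbove
  have hN' : ∀ n, N + 1 ≤ n → h (n + 1) ≤ ψ a (h n) := by
    intro n hn
    by_contra hc
    have h1 := hψp a (h n)
    have : n ≤ N := hN (by simp only [mem_ofPred_eq]; omega)
    omega
  have hit : ∀ k, h (N + 1 + k) ≤ (ψ a)^[k] (h (N + 1)) := by
    intro k
    induction k with
    | zero => simp
    | succ k ih =>
      rw [Function.iterate_succ_apply']
      exact (hN' (N + 1 + k) (by omega)).trans (hψm a ih)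
  obtain ⟨n, hn, hn'⟩ := (hg a).exists_gt (N + 1 + h (N + 1))
  simp only [mem_ofPred_eq] at hn
  have h1 := hit (n - (N + 1))
  rw [show N + 1 + (n - (N + 1)) = n by omega] at h1
  have h2 : (ψ a)^[n - (N + 1)] (h (N + 1)) ≤ (ψ a)^[n - (N + 1)] n :=
    (hψm a).iterate _ (by omega)
  have h3 : (ψ a)^[n - (N + 1)] n ≤ (ψ a)^[n] n :=
    Function.monotone_iterate_of_id_le (hψi a) (Nat.sub_le _ _) n
  have h4 := hhg n
  omega

/-- Basic open set given by a finite sequence. -/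
def cyl (s : List ℕ) : Set (ℕ → ℕ) := {y | ∀ i, i < s.length → y i = s.getD i 0}

theorem cyl_append (s t : List ℕ) : cyl (s ++ t) ⊆ cyl s := by
  intro y hy i hi
  rw [hy i (by simp; omega), List.getD_append _ _ _ _ hi]

theorem isOpen_cyl (s : List ℕ) : IsOpen (cyl s) := by
  have : cyl s = ⋂ i ∈ Finset.range s.length, (fun y : ℕ → ℕ => y i) ⁻¹' {s.getD i 0} := by
    ext y; simp [cyl]
  rw [this]
  exact isOpen_biInter_finset fun i _ => (isOpen_discrete _).preimage (continuous_apply i)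

theorem open_nhd {V : Set (ℕ → ℕ)} (hV : IsOpen V) {y : ℕ → ℕ} (hy : y ∈ V) :
    ∃ n, ∀ z : ℕ → ℕ, (∀ i < n, z i = y i) → z ∈ V := by
  obtain ⟨I, u, hu, hs⟩ := isOpen_pi_iff.1 hV y hy
  refine ⟨I.sup id + 1, fun z hz => hs ?_⟩
  intro i hi
  have : i ≤ I.sup id := Finset.le_sup (f := id) hi
  rw [hz i (by omega)]
  exact (hu i hi).2

theorem exists_ext {V : Set (ℕ → ℕ)} (hV : IsOpen V) (hd : Dense V) (s : List ℕ) :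
    ∃ t, cyl (s ++ t) ⊆ V := by
  obtain ⟨y, hy, hyV⟩ := hd.inter_open_nonempty (cyl s) (isOpen_cyl s)
    ⟨fun i => s.getD i 0, fun i _ => rfl⟩
  obtain ⟨n, hn⟩ := open_nhd hV hyV
  refine ⟨(List.range n).map (fun j => y (s.length + j)), fun z hz => hn z fun i hi => ?_⟩
  rw [hz i (by simp; omega)]
  by_cases h : i < s.length
  · rw [List.getD_append _ _ _ _ h, hy i h]
  · rw [List.getD_append_right _ _ _ _ (by omega)]
    rw [List.getD_eq_getElem _ _ (by simp; omega)]
    simp only [List.getElem_map, List.getElem_range]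
    congr 1; omega

theorem exists_ext_many {U : ℕ → Set (ℕ → ℕ)} (hU : ∀ k, IsOpen (U k)) (hd : ∀ k, Dense (U k))
    (s : ℕ → List ℕ) (m : ℕ) : ∃ t, ∀ i ≤ m, ∀ k ≤ m, cyl (s i ++ t) ⊆ U k := by
  have key : ∀ N : ℕ, ∃ t, ∀ j < N, cyl (s j.unpair.1 ++ t) ⊆ U j.unpair.2 := by
    intro N
    induction N with
    | zero => exact ⟨[], by simp⟩
    | succ N ih =>
      obtain ⟨t, ht⟩ := ih
      obtain ⟨t', ht'⟩ := exists_ext (hU N.unpair.2) (hd N.unpair.2) (s N.unpair.1 ++ t)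
      refine ⟨t ++ t', fun j hj => ?_⟩
      rw [← List.append_assoc]
      rcases Nat.lt_succ_iff_lt_or_eq.1 hj with h | rfl
      · exact (cyl_append _ _).trans (ht j h)
      · exact ht'
  obtain ⟨t, ht⟩ := key ((m + 1) ^ 2)
  refine ⟨t, fun i hi k hk => ?_⟩
  have := ht (Nat.pair i k) (lt_of_lt_of_le (Nat.pair_lt_max_add_one_sq i k)
    (Nat.pow_le_pow_left (by have := max_le hi hk; omega) 2))
  simpa using this

theorem meagre_seq {A : Set (ℕ → ℕ)} (hA : IsMeagre A) :
    ∃ U : ℕ → Set (ℕ → ℕ), (∀ k, IsOpen (U k)) ∧ (∀ k, Dense (U k)) ∧ (⋂ k, U k) ⊆ Aᶜ := by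
  obtain ⟨S, hSo, hSd, hSc, hS⟩ := mem_residual_iff.1 hA
  obtain ⟨U, hU⟩ := (hSc.insert univ).exists_eq_range (insert_nonempty _ _)
  have hmem : ∀ k, U k ∈ insert univ S := fun k => by rw [hU]; exact mem_range_self k
  refine ⟨U, fun k => ?_, fun k => ?_, ?_⟩
  · rcases hmem k with h | h
    · rw [h]; exact isOpen_univ
    · exact hSo _ h
  · rcases hmem k with h | h
    · rw [h]; exact dense_univ
    · exact hSd _ h
  · refine Subset.trans ?_ hS
    intro y hy T hT
    have : T ∈ range U := by rw [← hU]; exact mem_insert_of_mem _ hT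
    obtain ⟨k, rfl⟩ := this
    exact mem_iInter.1 hy k

theorem not_cover {ι : Type} (H : GuessIdx ι) (A : ι → Set (ℕ → ℕ)) (hA : ∀ a, IsMeagre (A a)) :
    ∃ y, ∀ a, y ∉ A a := by
  choose U hUo hUd hUA using fun a => meagre_seq (hA a)
  choose φ hφ using fun a m => exists_ext_many (hUo a) (hUd a) (Denumerable.ofNat (List ℕ)) m
  obtain ⟨h, hm, hX⟩ := escape H (fun a m => ∑ i ∈ Finset.range (m + 1),
    Encodable.encode (Denumerable.ofNat (List ℕ) i ++ φ a m))
  obtain ⟨g, hg⟩ := guess_on_sets' H (fun a n => φ a (h n)) _ hX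
  let s : ℕ → List ℕ := fun n => Nat.rec []
    (fun n s => if Encodable.encode (s ++ g n) ≤ h (n + 1) then s ++ g n else s) n
  have hs : ∀ n, s (n + 1) =
    if Encodable.encode (s n ++ g n) ≤ h (n + 1) then s n ++ g n else s n := fun n => rfl
  have hsb : ∀ n, Encodable.encode (s n) ≤ h n := by
    intro n
    induction n with
    | zero => simp [s]
    | succ n ih =>
      rw [hs]
      split_ifs with hc
      · exact hc
      · exact ih.trans (hm (Nat.lt_succ_self n)).le
  have hpre : ∀ m n, m ≤ n → s m <+: s n := by
    intro m n hmn
    induction n, hmn using Nat.le_induction with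
    | base => exact List.prefix_rfl
    | succ n _ ih =>
      refine ih.trans ?_
      rw [hs]
      split_ifs
      · exact List.prefix_append _ _
      · exact List.prefix_rfl
  have hcoh : ∀ m n i, i < (s m).length → i < (s n).length →
      (s m).getD i 0 = (s n).getD i 0 := by
    have aux : ∀ m n i, m ≤ n → i < (s m).length → (s m).getD i 0 = (s n).getD i 0 := by
      intro m n i hmn hi
      obtain ⟨t, ht⟩ := hpre m n hmn
      rw [← ht, List.getD_append _ _ _ _ hi]
    intro m n i h1 h2
    rcases le_total m n with h' | h'
    · exact aux m n i h' h1
    · exact (aux n m i h' h2).symm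
  classical
  let y : ℕ → ℕ := fun i => if hi : ∃ n, i < (s n).length then (s hi.choose).getD i 0 else 0
  have hy : ∀ n, y ∈ cyl (s n) := by
    intro n i hi
    have hex : ∃ n, i < (s n).length := ⟨n, hi⟩
    simp only [y, dif_pos hex]
    exact hcoh _ _ _ hex.choose_spec hi
  refine ⟨y, fun a => hUA a (mem_iInter.2 fun k => ?_)⟩
  obtain ⟨n, ⟨hn1, hn2⟩, hkn⟩ := (hg a).exists_gt k
  simp only [mem_ofPred_eq] at hn1
  have hsn := hsb n
  have hle : Encodable.encode (s n ++ φ a (h n)) ≤ h (n + 1) := by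
    refine le_trans ?_ hn1
    have := Finset.single_le_sum (s := Finset.range (h n + 1))
      (f := fun i => Encodable.encode (Denumerable.ofNat (List ℕ) i ++ φ a (h n)))
      (fun _ _ => Nat.zero_le _)
      (Finset.mem_range.2 (Nat.lt_succ_of_le hsn))
    simpa only [Denumerable.ofNat_encode] using this
  have e : s (n + 1) = s n ++ φ a (h n) := by
    rw [hs, hn2, if_pos hle]
  have h1 := hφ a (h n) _ hsn k (hkn.le.trans (hm.id_le n))
  rw [Denumerable.ofNat_encode, ← e] at h1
  exact h1 (hy (n + 1))

theorem meagre_ne (x : ℕ → ℕ) : IsMeagre {g : ℕ → ℕ | ¬ {n | g n = x n}.Infinite} := by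
  have hN : ∀ N : ℕ, {g : ℕ → ℕ | ∃ n, N < n ∧ g n = x n} ∈ residual (ℕ → ℕ) := by
    intro N
    refine residual_of_dense_open ?_ ?_
    · have : {g : ℕ → ℕ | ∃ n, N < n ∧ g n = x n} =
          ⋃ n ∈ {n | N < n}, (fun g : ℕ → ℕ => g n) ⁻¹' {x n} := by
        ext g; simp
      rw [this]
      exact isOpen_biUnion fun n _ => (isOpen_discrete _).preimage (continuous_apply n)
    · rw [dense_iff_inter_open]
      rintro O hO ⟨y, hy⟩
      obtain ⟨n, hn⟩ := open_nhd hO hy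
      refine ⟨Function.update y (n + N + 1) (x (n + N + 1)), hn _ fun i hi => ?_,
        n + N + 1, by omega, by simp⟩
      rw [Function.update_of_ne (by omega)]
  refine Filter.mem_of_superset (countable_iInter_mem.2 hN) ?_
  intro g hg
  simp only [mem_compl_iff, mem_ofPred_eq, not_not]
  refine Set.infinite_of_forall_exists_gt fun N => ?_
  obtain ⟨n, h1, h2⟩ := mem_iInter.1 hg N
  exact ⟨n, h2, h1⟩

theorem cov_le {X : Set (ℕ → ℕ)} (hX : ¬ Guessable X) :
    ∃ F : Set (Set (ℕ → ℕ)), Cardinal.mk F ≤ Cardinal.mk X ∧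
    (∀ A ∈ F, IsMeagre A) ∧ ⋃₀ F = Set.univ := by
  refine ⟨(fun x => {g : ℕ → ℕ | ¬ {n | g n = x n}.Infinite}) '' X, Cardinal.mk_image_le, ?_, ?_⟩
  · rintro _ ⟨x, _, rfl⟩
    exact meagre_ne x
  · refine eq_univ_of_forall fun g => ?_
    by_contra hc
    refine hX ⟨g, fun x hx => ?_⟩
    by_contra hi
    exact hc ⟨_, ⟨x, hx, rfl⟩, hi⟩

theorem covMeager_le {X : Set (ℕ → ℕ)} (hX : ¬ Guessable X) : covMeager ≤ Cardinal.mk X := by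
  obtain ⟨F, hF, h⟩ := cov_le hX
  exact (csInf_le' ⟨F, rfl, h⟩ : covMeager ≤ Cardinal.mk F).trans hF

theorem not_guessable_univ : ¬ Guessable Set.univ := by
  rintro ⟨g, hg⟩
  have := hg (fun n => g n + 1) (mem_univ _)
  simp at this

/-- The minimal cardinality of a non-guessable subset of `ℕ^ℕ` equals cov(M);
in particular every family of size `< cov(M)` is guessable. -/
theorem stmt12 :
    sInf {c | ∃ X : Set (ℕ → ℕ), Cardinal.mk X = c ∧ ¬ Guessable X} = covMeager ∧
    ∀ X : Set (ℕ → ℕ), Cardinal.mk X < covMeager →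
      ∃ g : ℕ → ℕ, ∀ x ∈ X, {n | g n = x n}.Infinite := by
  refine ⟨le_antisymm ?_ ?_, ?_⟩
  · obtain ⟨F0, _, hF0⟩ := cov_le not_guessable_univ
    refine le_csInf ⟨_, F0, rfl, hF0⟩ ?_
    rintro _ ⟨F, rfl, hFm, hFu⟩
    by_contra hlt
    rw [not_le] at hlt
    have H : GuessIdx F := by
      intro f
      have hG : Guessable (range f) := by
        by_contra hc
        exact absurd (lt_of_le_of_lt Cardinal.mk_range_le hlt)
          (not_lt.2 (csInf_le' ⟨_, rfl, hc⟩))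
      obtain ⟨g, hg⟩ := hG
      exact ⟨g, fun a => hg _ (mem_range_self a)⟩
    obtain ⟨y, hy⟩ := not_cover H (fun a : F => (a : Set (ℕ → ℕ))) (fun a => hFm a a.2)
    have : y ∈ ⋃₀ F := by rw [hFu]; exact mem_univ y
    obtain ⟨A, hA, hyA⟩ := this
    exact hy ⟨A, hA⟩ hyA
  · refine le_csInf ⟨_, univ, rfl, not_guessable_univ⟩ ?_
    rintro _ ⟨X, rfl, hX⟩
    exact covMeager_le hX
  · intro X hX
    by_contra hc
    exact absurd hX (not_lt.2 (covMeager_le hc))
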